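/- arXiv:2101.05057 — 4 statements merged into one kernel-verified Lean document; each statement's English description precedes it below -/
import Mathlib

section
/- Let A = (Q, Σ, δ) be a strongly connected synchronizing partial DFA with n states, and let w ∈ Σ* be a word with R = δ(Q,w) ≠ ∅. Let A^{I} be the induced automaton on R with W₁ = {w} and W₂ = Σ^{≤ n−1} (alphabet Σ^{≤n−1}{w}). Then rt(A) ≤ |w| + (|w| + n − 1)·rt(A^{I}), where rt denotes the reset threshold (for A^{I}, its reset threshold counts letters of A^{I}, i.e., words of Σ^{≤n−1}{w}). -/
open scoped Classical

section Defs

variable {Q A : Type*}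

/-- Action of a word in a partial DFA with transition function `δ`
(`none` means the undefined value ⊥). -/
def stepWord (δ : Q → A → Option Q) : Q → List A → Option Q
  | q, [] => some q
  | q, a :: w => (δ q a).bind (fun p => stepWord δ p w)

/-- The image `δ(S, w)` of a set of states under the action of a word. -/
def img (δ : Q → A → Option Q) (S : Set Q) (w : List A) : Set Q :=
  {p | ∃ q ∈ S, stepWord δ q w = some p}

/-- The inseparability equivalence `p ≡ q`. -/
def Insep (δ : Q → A → Option Q) (p q : Q) : Prop :=
  ∀ u : List A, (stepWord δ p u).isSome ↔ (stepWord δ q u).isSome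

/-- `κ(S)`: the number of inseparability classes intersecting `S`. -/
noncomputable def kappa (δ : Q → A → Option Q) (S : Set Q) : ℕ :=
  {C : Set Q | ∃ p ∈ S, C = {q | Insep δ p q}}.ncard

def StronglyConnected (δ : Q → A → Option Q) : Prop :=
  ∀ p q : Q, ∃ w : List A, stepWord δ p w = some q

/-- The transition function of the fixing automaton `A^F`. -/
def fixDelta (δ : Q → A → Option Q) (q : Q) (a : A) : Q := (δ q a).getD q

/-- Action of a word in a complete DFA. -/
def stepWordC (δc : Q → A → Q) (q : Q) (w : List A) : Q := w.foldl δc q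

/-- The image of a set of states under the action of a word in a complete DFA. -/
def imgC (δc : Q → A → Q) (S : Set Q) (w : List A) : Set Q :=
  (fun q => stepWordC δc q w) '' S

end Defs

theorem stepWord_append {Q A : Type*} (δ : Q → A → Option Q) (q : Q) (u v : List A) :
    stepWord δ q (u ++ v) = (stepWord δ q u).bind (fun p => stepWord δ p v) := by
  induction u generalizing q with
  | nil => rfl
  | cons a u ih =>
    simp only [List.cons_append, stepWord, Option.bind_assoc, ih]

theorem img_append {Q A : Type*} (δ : Q → A → Option Q) (S : Set Q) (u v : List A) :
    img δ S (u ++ v) = img δ (img δ S u) v := by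
  ext p
  simp only [img, Set.mem_ofPred_eq, stepWord_append, Option.bind_eq_some_iff]
  constructor
  · rintro ⟨q, hq, r, hr, hp⟩
    exact ⟨r, ⟨q, hq, hr⟩, hp⟩
  · rintro ⟨r, ⟨q, hq, hr⟩, hp⟩
    exact ⟨q, hq, r, hr, hp⟩

theorem img_mono {Q A : Type*} (δ : Q → A → Option Q) {S T : Set Q} (h : S ⊆ T) (u : List A) :
    img δ S u ⊆ img δ T u :=
  fun _ ⟨q, hq, hp⟩ => ⟨q, h hq, hp⟩

/-- The linear action of a letter on functions on the states, where `⊥` has value `0`. -/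
def letterMap {Q A : Type*} (δ : Q → A → Option Q) (a : A) : (Q → ℚ) →ₗ[ℚ] (Q → ℚ) where
  toFun y q := (δ q a).elim 0 y
  map_add' y z := by
    ext q
    cases h : δ q a <;> simp [h]
  map_smul' c y := by
    ext q
    cases h : δ q a <;> simp [h]

/-- The pullback of a function on the states along a word, where `⊥` has value `0`. -/
def pullback {Q A : Type*} (δ : Q → A → Option Q) (y : Q → ℚ) (v : List A) : Q → ℚ :=
  fun q => (stepWord δ q v).elim 0 y

theorem pullback_cons {Q A : Type*} (δ : Q → A → Option Q) (y : Q → ℚ) (a : A) (v : List A) :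
    pullback δ y (a :: v) = letterMap δ a (pullback δ y v) := by
  ext q
  cases h : δ q a <;> simp [pullback, letterMap, stepWord, h]

/-- The span of the pullbacks of `y` along words of length at most `k`. -/
def pullbackSpan {Q A : Type*} (δ : Q → A → Option Q) (y : Q → ℚ) (k : ℕ) :
    Submodule ℚ (Q → ℚ) :=
  Submodule.span ℚ (pullback δ y '' {v | v.length ≤ k})

theorem pullback_mem_pullbackSpan {Q A : Type*} (δ : Q → A → Option Q) (y : Q → ℚ) {k : ℕ}
    {v : List A} (hv : v.length ≤ k) : pullback δ y v ∈ pullbackSpan δ y k :=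
  Submodule.subset_span ⟨v, hv, rfl⟩

theorem pullbackSpan_le_succ {Q A : Type*} (δ : Q → A → Option Q) (y : Q → ℚ) (k : ℕ) :
    pullbackSpan δ y k ≤ pullbackSpan δ y (k + 1) :=
  Submodule.span_mono (Set.image_mono fun _ hv => Nat.le_succ_of_le hv)

theorem letterMap_mem_pullbackSpan {Q A : Type*} (δ : Q → A → Option Q) (y : Q → ℚ) (k : ℕ)
    (a : A) {z : Q → ℚ} (hz : z ∈ pullbackSpan δ y k) :
    letterMap δ a z ∈ pullbackSpan δ y (k + 1) := by
  suffices h : pullbackSpan δ y k ≤ (pullbackSpan δ y (k + 1)).comap (letterMap δ a) from h hz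
  refine Submodule.span_le.2 ?_
  rintro _ ⟨v, hv, rfl⟩
  change letterMap δ a (pullback δ y v) ∈ pullbackSpan δ y (k + 1)
  rw [← pullback_cons]
  exact pullback_mem_pullbackSpan δ y (by simpa using hv)

theorem pullback_mem_of_stable {Q A : Type*} (δ : Q → A → Option Q) (y : Q → ℚ) (k : ℕ)
    (h : pullbackSpan δ y (k + 1) ≤ pullbackSpan δ y k) (v : List A) :
    pullback δ y v ∈ pullbackSpan δ y k := by
  induction v with
  | nil => exact pullback_mem_pullbackSpan δ y (Nat.zero_le k)
  | cons a v ih =>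
    rw [pullback_cons]
    exact h (letterMap_mem_pullbackSpan δ y k a ih)

theorem pullback_mem_or_le_finrank {Q A : Type*} [Fintype Q] (δ : Q → A → Option Q) (y : Q → ℚ)
    (hy : y ≠ 0) (k : ℕ) :
    (∀ v, pullback δ y v ∈ pullbackSpan δ y k) ∨
      k + 1 ≤ Module.finrank ℚ (pullbackSpan δ y k) := by
  induction k with
  | zero =>
    right
    have hmem : y ∈ pullbackSpan δ y 0 :=
      pullback_mem_pullbackSpan δ y (v := []) (Nat.zero_le 0)
    refine Submodule.one_le_finrank_iff.2 fun h => hy ?_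
    rwa [h, Submodule.mem_bot] at hmem
  | succ k ih =>
    rcases ih with h | h
    · exact Or.inl fun v => pullbackSpan_le_succ δ y k (h v)
    · by_cases hle : pullbackSpan δ y (k + 1) ≤ pullbackSpan δ y k
      · exact Or.inl fun v => pullbackSpan_le_succ δ y k (pullback_mem_of_stable δ y k hle v)
      · right
        have := Submodule.finrank_lt_finrank_of_lt
          (lt_of_le_not_ge (pullbackSpan_le_succ δ y k) hle)
        omega

/-- Words of length less than the number of states span all pullbacks. -/
theorem pullback_mem_pullbackSpan_card {Q A : Type*} [Fintype Q] (δ : Q → A → Option Q)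
    (y : Q → ℚ) (v : List A) : pullback δ y v ∈ pullbackSpan δ y (Fintype.card Q - 1) := by
  by_cases hy : y = 0
  · have : pullback δ y v = 0 := by
      ext q
      cases h : stepWord δ q v <;> simp [pullback, h, hy]
    rw [this]
    exact Submodule.zero_mem _
  · rcases pullback_mem_or_le_finrank δ y hy (Fintype.card Q - 1) with h | h
    · exact h v
    · have htop : pullbackSpan δ y (Fintype.card Q - 1) = ⊤ := by
        refine Submodule.eq_top_of_finrank_eq (le_antisymm (Submodule.finrank_le _) ?_)
        rw [Module.finrank_fintype_fun_eq_card]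
        omega
      rw [htop]
      exact Submodule.mem_top

theorem sum_pullback_eq_zero {Q A : Type*} [Fintype Q] (δ : Q → A → Option Q) (y : Q → ℚ)
    (S : Finset Q)
    (h : ∀ v : List A, v.length ≤ Fintype.card Q - 1 → ∑ p ∈ S, pullback δ y v p = 0)
    (v : List A) : ∑ p ∈ S, pullback δ y v p = 0 := by
  let φ : (Q → ℚ) →ₗ[ℚ] ℚ := ∑ p ∈ S, LinearMap.proj p
  have hφ : ∀ z, φ z = ∑ p ∈ S, z p := fun z => by simp [φ]
  have hle : pullbackSpan δ y (Fintype.card Q - 1) ≤ LinearMap.ker φ := by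
    refine Submodule.span_le.2 ?_
    rintro _ ⟨v, hv, rfl⟩
    exact LinearMap.mem_ker.2 ((hφ _).trans (h v hv))
  rw [← hφ]
  exact LinearMap.mem_ker.1 (hle (pullback_mem_pullbackSpan_card δ y v))

/-- The number of states of `S` that the word `u` sends to `s`. -/
noncomputable def fiberCount {Q A : Type*} (δ : Q → A → Option Q) (S : Finset Q) (u : List A)
    (s : Q) : ℚ :=
  ∑ p ∈ S, if stepWord δ p u = some s then 1 else 0

theorem fiberCount_eq_zero {Q A : Type*} (δ : Q → A → Option Q) {S : Finset Q} {u : List A}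
    {s : Q} (h : s ∉ img δ (S : Set Q) u) : fiberCount δ S u s = 0 :=
  Finset.sum_eq_zero fun p hp => if_neg fun hps => h ⟨p, hp, hps⟩

theorem fiberCount_pos {Q A : Type*} (δ : Q → A → Option Q) {S : Finset Q} {u : List A}
    {s : Q} (h : s ∈ img δ (S : Set Q) u) : 0 < fiberCount δ S u s := by
  obtain ⟨p, hp, hps⟩ := h
  refine Finset.sum_pos' (fun q _ => by split_ifs <;> norm_num) ⟨p, hp, ?_⟩
  rw [if_pos hps]
  exact one_pos

theorem fiberCount_eq_one {Q A : Type*} (δ : Q → A → Option Q) {S : Finset Q} {u : List A}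
    (h : img δ (S : Set Q) u = S) {s : Q} (hs : s ∈ S) : fiberCount δ S u s = 1 := by
  have hsub : S.image some ⊆ S.image (fun p => stepWord δ p u) := by
    intro x hx
    obtain ⟨t, ht, rfl⟩ := Finset.mem_image.1 hx
    have ht' : t ∈ img δ (S : Set Q) u := by rw [h]; exact ht
    obtain ⟨p, hp, hpt⟩ := ht'
    exact Finset.mem_image.2 ⟨p, hp, hpt⟩
  have hcard : (S.image (fun p => stepWord δ p u)).card = S.card := by
    refine le_antisymm Finset.card_image_le ?_
    rw [← Finset.card_image_of_injective S (Option.some_injective Q)]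
    exact Finset.card_le_card hsub
  have hinj := Finset.card_image_iff.1 hcard
  have hs' : s ∈ img δ (S : Set Q) u := by rw [h]; exact hs
  obtain ⟨p, hp, hps⟩ := hs'
  unfold fiberCount
  rw [Finset.sum_eq_single_of_mem p hp, if_pos hps]
  intro q hq hqp
  exact if_neg fun hqs => hqp (hinj hq hp (hqs.trans hps.symm))

theorem sum_pullback_indicator {Q A : Type*} (δ : Q → A → Option Q) (S : Finset Q)
    (x v : List A) (s t : Q) :
    ∑ p ∈ S, pullback δ (fun q => (if stepWord δ q x = some s then 1 else 0) -
      (if stepWord δ q x = some t then 1 else 0)) v p =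
      fiberCount δ S (v ++ x) s - fiberCount δ S (v ++ x) t := by
  unfold fiberCount
  rw [← Finset.sum_sub_distrib]
  refine Finset.sum_congr rfl fun p _ => ?_
  cases h : stepWord δ p v <;> simp [pullback, stepWord_append, h]

/-- If every short word followed by `x` permutes `S` or is undefined on it, then the fibers over
the states of `S` have equal sizes for all words followed by `x`. -/
theorem fiberCount_eq_of_short {Q A : Type*} [Fintype Q] (δ : Q → A → Option Q) (S : Finset Q)
    (x : List A)
    (h : ∀ v : List A, v.length ≤ Fintype.card Q - 1 →
      img δ (S : Set Q) (v ++ x) = ∅ ∨ img δ (S : Set Q) (v ++ x) = S)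
    (v : List A) {s t : Q} (hs : s ∈ S) (ht : t ∈ S) :
    fiberCount δ S (v ++ x) s = fiberCount δ S (v ++ x) t := by
  rw [← sub_eq_zero, ← sum_pullback_indicator]
  refine sum_pullback_eq_zero δ _ S (fun v hv => ?_) v
  rw [sum_pullback_indicator]
  rcases h v hv with h | h
  · rw [fiberCount_eq_zero δ (by simp [h]), fiberCount_eq_zero δ (by simp [h]), sub_zero]
  · rw [fiberCount_eq_one δ h hs, fiberCount_eq_one δ h ht, sub_self]

/-- A nonempty set `S` that is the image of a word `x` and that every short word followed by `x`
permutes or is undefined on is a singleton. -/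
theorem ncard_eq_one_of_short {Q A : Type*} [Fintype Q] (δ : Q → A → Option Q)
    (hsc : StronglyConnected δ) (hsync : ∃ u : List A, (img δ Set.univ u).ncard = 1)
    (S : Set Q) (hS : S.Nonempty) (x : List A) (hx : img δ Set.univ x = S)
    (h : ∀ v : List A, v.length ≤ Fintype.card Q - 1 →
      img δ S (v ++ x) = ∅ ∨ img δ S (v ++ x) = S) : S.ncard = 1 := by
  obtain ⟨u, hu⟩ := hsync
  obtain ⟨r, hr⟩ := Set.ncard_eq_one.1 hu
  obtain ⟨p, -, hp⟩ : r ∈ img δ Set.univ u := by rw [hr]; rfl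
  obtain ⟨s, hs⟩ := hS
  obtain ⟨q, -, hq⟩ : s ∈ img δ Set.univ x := by rw [hx]; exact hs
  obtain ⟨b, hb⟩ := hsc s p
  obtain ⟨c, hc⟩ := hsc r q
  have hstep : stepWord δ s ((b ++ (u ++ c)) ++ x) = some s := by
    simp [stepWord_append, hb, hp, hc, hq]
  have huniq : ∀ t ∈ img δ Set.univ ((b ++ (u ++ c)) ++ x), t = s := by
    intro t ht
    rw [List.append_assoc, List.append_assoc, img_append, img_append] at ht
    obtain ⟨r', hr', ht⟩ := img_mono δ (img_mono δ (Set.subset_univ _) u) (c ++ x) ht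
    rw [hr] at hr'
    rw [Set.mem_singleton_iff.1 hr', stepWord_append, hc, Option.bind_some, hq] at ht
    exact (Option.some_injective _ ht).symm
  refine Set.ncard_eq_one.2 ⟨s, Set.eq_singleton_iff_unique_mem.2 ⟨hs, fun t ht => ?_⟩⟩
  have hcoe : ((S.toFinset : Finset Q) : Set Q) = S := Set.coe_toFinset S
  have heq := fiberCount_eq_of_short δ S.toFinset x (by rwa [hcoe]) (b ++ (u ++ c))
    (Set.mem_toFinset.2 hs) (Set.mem_toFinset.2 ht)
  have hpos : 0 < fiberCount δ S.toFinset ((b ++ (u ++ c)) ++ x) s :=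
    fiberCount_pos δ ⟨s, by rwa [hcoe], hstep⟩
  by_contra hne
  rw [heq, fiberCount_eq_zero δ fun hmem => hne
    (huniq t (img_mono δ (Set.subset_univ _) _ hmem))] at hpos
  exact lt_irrefl _ hpos

/-- The automaton induced by a word `w` with nonempty image is synchronizing. -/
theorem exists_induced_reset {Q A : Type*} [Fintype Q] (δ : Q → A → Option Q)
    (hsc : StronglyConnected δ) (hsync : ∃ u : List A, (img δ Set.univ u).ncard = 1)
    (w : List A) (hR : (img δ Set.univ w).Nonempty) :
    ∃ ws : List (List A),
      (∀ u ∈ ws, ∃ v : List A, v.length ≤ Fintype.card Q - 1 ∧ u = v ++ w) ∧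
      (img δ (img δ Set.univ w) ws.flatten).ncard = 1 := by
  have hex : ∃ k : ℕ, ∃ ws : List (List A),
      (∀ u ∈ ws, ∃ v : List A, v.length ≤ Fintype.card Q - 1 ∧ u = v ++ w) ∧
      (img δ (img δ Set.univ w) ws.flatten).Nonempty ∧
      (img δ (img δ Set.univ w) ws.flatten).ncard = k := by
    refine ⟨_, [], by simp, ?_, rfl⟩
    obtain ⟨p, hp⟩ := hR
    exact ⟨p, p, hp, rfl⟩
  obtain ⟨ws, hws, hne, hcard⟩ := Nat.find_spec hex
  refine ⟨ws, hws, ncard_eq_one_of_short δ hsc hsync _ hne (w ++ ws.flatten)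
    (img_append δ _ _ _) fun v hv => ?_⟩
  refine (Set.eq_empty_or_nonempty _).imp_right fun hne' => ?_
  refine Set.eq_of_subset_of_ncard_le ?_ ?_ (Set.toFinite _)
  · rw [img_append, ← img_append δ Set.univ w ws.flatten]
    rw [img_append δ Set.univ w, img_append δ (img δ _ v) w]
    exact img_mono δ (img_mono δ (Set.subset_univ _) w) _
  · rw [hcard]
    have hflat : img δ (img δ (img δ Set.univ w) ws.flatten) (v ++ (w ++ ws.flatten)) =
        img δ (img δ Set.univ w) (ws ++ (v ++ w) :: ws).flatten := by
      rw [← img_append]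
      simp
    rw [hflat] at hne' ⊢
    refine Nat.find_min' hex ⟨_, fun u hu => ?_, hne', rfl⟩
    rcases List.mem_append.1 hu with hu | hu
    · exact hws u hu
    · rcases List.mem_cons.1 hu with rfl | hu
      · exact ⟨v, hv, rfl⟩
      · exact hws u hu

theorem length_flatten_le {A : Type*} (ws : List (List A)) (c : ℕ)
    (h : ∀ u ∈ ws, u.length ≤ c) : ws.flatten.length ≤ c * ws.length := by
  induction ws with
  | nil => simp
  | cons u ws ih =>
    have hu := h u List.mem_cons_self
    have hws := ih fun x hx => h x (List.mem_cons_of_mem u hx)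
    rw [List.flatten_cons, List.length_append, List.length_cons, Nat.mul_succ]
    omega


/-- for a strongly connected synchronizing partial DFA `A` and a word `w`
with `R = δ(Q,w) ≠ ∅`, the reset threshold of `A` is at most
`|w| + (|w| + n − 1)·rt(A^I)`, where `A^I` is the induced automaton on `R` with alphabet
`Σ^{≤n−1}{w}` and its reset threshold counts its letters (words of the form `vw` with
`|v| ≤ n − 1`). -/
theorem stmt12 {Q A : Type*} [Fintype Q] (δ : Q → A → Option Q) (n : ℕ)
    (hn : n = Fintype.card Q)
    (hsc : StronglyConnected δ)
    (hsync : ∃ u : List A, (img δ Set.univ u).ncard = 1)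
    (w : List A) (hR : (img δ Set.univ w).Nonempty) :
    sInf {k : ℕ | ∃ u : List A, u.length = k ∧ (img δ Set.univ u).ncard = 1} ≤
      w.length + (w.length + n - 1) *
        sInf {k : ℕ | ∃ ws : List (List A),
          (∀ u ∈ ws, ∃ v : List A, v.length ≤ n - 1 ∧ u = v ++ w) ∧
          ws.length = k ∧ (img δ (img δ Set.univ w) ws.flatten).ncard = 1} := by
  subst hn
  obtain ⟨ws₀, hws₀, hcard₀⟩ := exists_induced_reset δ hsc hsync w hR
  obtain ⟨ws, hws, hlen, hcard⟩ := Nat.sInf_mem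
    (s := {k : ℕ | ∃ ws : List (List A),
      (∀ u ∈ ws, ∃ v : List A, v.length ≤ Fintype.card Q - 1 ∧ u = v ++ w) ∧
      ws.length = k ∧ (img δ (img δ Set.univ w) ws.flatten).ncard = 1})
    ⟨_, ws₀, hws₀, rfl, hcard₀⟩
  rw [← hlen]
  have hQ : 0 < Fintype.card Q := Fintype.card_pos_iff.2 ⟨hR.some⟩
  have hle := length_flatten_le ws (w.length + Fintype.card Q - 1) fun u hu => by
    obtain ⟨v, hv, rfl⟩ := hws u hu
    rw [List.length_append]
    omega
  have hmem : (w ++ ws.flatten).length ∈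
      {k : ℕ | ∃ u : List A, u.length = k ∧ (img δ Set.univ u).ncard = 1} :=
    ⟨w ++ ws.flatten, rfl, by rw [img_append]; exact hcard⟩
  refine (Nat.sInf_le hmem).trans ?_
  rw [List.length_append]
  exact Nat.add_le_add_left hle _
end

section
/- Let X = {x} be a one-word prefix code over a finite alphabet Σ, and suppose x = y^k where y is a non-empty primitive word and k ≥ 1. Then the literal automaton A_X has minimal non-zero rank exactly k, and if A_X is synchronizing (i.e., k = 1), then rt(A_X) ≤ |x|/2. -/
open scoped Classical

variable {A : Type*}

/-- `X` is a prefix code: no codeword is a prefix of another codeword. -/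
def IsPrefixCode (X : Set (List A)) : Prop :=
  ∀ x ∈ X, ∀ y ∈ X, x <+: y → x = y

/-- The states of the literal automaton of `X`: proper prefixes of codewords
(the empty prefix `[]` is the root state). -/
def ProperPrefixes (X : Set (List A)) : Set (List A) :=
  {q | ∃ x ∈ X, q <+: x ∧ q ≠ x}

/-- The transition function of the literal automaton `A_X`:
`δ(q,a) = qa` if `qa` is a proper prefix of a codeword, `δ(q,a) = ε` (the root) if
`qa ∈ X`, and `δ(q,a) = ⊥` otherwise. -/
noncomputable def litDelta (X : Set (List A)) (q : ProperPrefixes X) (a : A) :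
    Option (ProperPrefixes X) :=
  if h : (q.val ++ [a]) ∈ ProperPrefixes X then some ⟨q.val ++ [a], h⟩
  else if h2 : (q.val ++ [a]) ∈ X then
    some ⟨[], ⟨q.val ++ [a], h2, List.nil_prefix, by simp⟩⟩
  else none

/-- The factor of length `l` starting at position `i` of the infinite word `f`. -/
def factor {A : Type*} (f : ℕ → A) : ℕ → ℕ → List A
  | 0, _ => []
  | l + 1, i => f i :: factor f l (i + 1)

section Factor

variable {f : ℕ → A}

@[simp] theorem length_factor (l i : ℕ) : (factor f l i).length = l := by
  induction l generalizing i with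
  | zero => rfl
  | succ l ih => simp [factor, ih]

theorem factor_add (a b i : ℕ) : factor f (a + b) i = factor f a i ++ factor f b (i + a) := by
  induction a generalizing i with
  | zero => simp [factor]
  | succ a ih =>
    rw [Nat.add_right_comm]
    simp [factor, ih, Nat.add_assoc, Nat.add_comm 1 a]

theorem factor_succ (l i : ℕ) : factor f (l + 1) i = factor f l i ++ [f (i + l)] := by
  rw [factor_add]
  rfl

theorem factor_eq_iff {l i j : ℕ} :
    factor f l i = factor f l j ↔ ∀ t < l, f (i + t) = f (j + t) := by
  induction l with
  | zero => simp [factor]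
  | succ l ih =>
    rw [factor_succ, factor_succ, ← List.concat_eq_append, ← List.concat_eq_append,
      List.concat_inj, ih]
    exact Nat.forall_lt_succ_right.symm

theorem factor_prefix {a b : ℕ} (h : a ≤ b) (i : ℕ) : factor f a i <+: factor f b i := by
  obtain ⟨c, rfl⟩ := Nat.exists_eq_add_of_le h
  exact ⟨_, (factor_add a c i).symm⟩

theorem getElem_factor {l i t : ℕ} (h : t < (factor f l i).length) :
    (factor f l i)[t] = f (i + t) := by
  induction l generalizing i t with
  | zero => simp [factor] at h
  | succ l ih =>
    cases t with
    | zero => rfl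
    | succ t => simp [factor, ih, Nat.add_assoc, Nat.add_comm 1]

theorem factor_mod {n : ℕ} (hf : Function.Periodic f n) (l i : ℕ) :
    factor f l (i % n) = factor f l i := by
  rw [factor_eq_iff]
  intro t _
  rw [← hf.map_mod_nat (i % n + t), ← hf.map_mod_nat (i + t), Nat.mod_add_mod]

theorem factor_mul {d : ℕ} (hf : Function.Periodic f d) (m : ℕ) :
    factor f (m * d) 0 = (List.replicate m (factor f d 0)).flatten := by
  induction m with
  | zero => simp [factor]
  | succ m ih =>
    rw [Nat.succ_mul, Nat.add_comm, factor_add, List.replicate_succ, List.flatten_cons, ← ih,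
      ← factor_mod hf (m * d) (0 + d)]
    simp

theorem factor_getElem_mod (y : List A) (hy : 0 < y.length) :
    factor (fun i => y[i % y.length]'(Nat.mod_lt _ hy)) y.length 0 = y := by
  refine List.ext_getElem (length_factor _ _) fun i _ hi => ?_
  rw [getElem_factor]
  simp [Nat.mod_eq_of_lt hi]

/-- A word of period `n` whose tails at positions `i < j < n` agree has a proper divisor of `n` as
a period. -/
theorem exists_dvd_periodic {n : ℕ} (hf : Function.Periodic f n) {i j : ℕ} (hij : i < j)
    (hj : j < n) (h : ∀ t, f (i + t) = f (j + t)) :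
    ∃ d, d ∣ n ∧ d < n ∧ Function.Periodic f d := by
  have hd : Function.Periodic f (j - i) := by
    intro s
    have h1 := h (s + (n - i))
    rw [show i + (s + (n - i)) = s + n by omega,
      show j + (s + (n - i)) = s + (j - i) + n by omega, hf, hf] at h1
    exact h1.symm
  have hlt : Nat.gcd (j - i) n < n :=
    (Nat.gcd_le_left _ (by omega)).trans_lt (by omega)
  refine ⟨Nat.gcd (j - i) n, Nat.gcd_dvd_right _ _, hlt, fun s => ?_⟩
  obtain ⟨m, -, hm⟩ := Nat.exists_mul_mod_eq_gcd hlt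
  have h2 : f (s + (j - i) * m) = f s := by
    have := hd.nat_mul m s
    simpa [mul_comm] using this
  rw [← hm, ← h2, ← hf.map_mod_nat, Nat.add_mod_mod, hf.map_mod_nat]

theorem image_take_factor_succ (n l : ℕ) :
    ((Finset.range n).image (factor f (l + 1))).image (List.take l) =
      (Finset.range n).image (factor f l) := by
  rw [Finset.image_image]
  exact Finset.image_congr fun i _ => by simp [factor_succ]

theorem card_image_factor_lt {n l : ℕ} (hn : 0 < n) (hf : Function.Periodic f n)
    (hinj : ∀ i < n, ∀ j < n, (∀ t, f (i + t) = f (j + t)) → i = j)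
    (hl : ((Finset.range n).image (factor f l)).card < n) :
    ((Finset.range n).image (factor f l)).card <
      ((Finset.range n).image (factor f (l + 1))).card := by
  have himg := image_take_factor_succ (f := f) n l
  refine lt_of_le_of_ne (himg.symm ▸ Finset.card_image_le) fun heq => hl.ne ?_
  rw [← himg] at heq
  have hinj' := Finset.card_image_iff.mp heq
  have hext : ∀ i j, factor f l i = factor f l j → factor f (l + 1) i = factor f (l + 1) j := by
    intro i j hij
    rw [← factor_mod hf _ i, ← factor_mod hf _ j]
    refine hinj' ?_ ?_ ?_
    · exact Finset.mem_coe.2 (Finset.mem_image_of_mem _ (Finset.mem_range.2 (Nat.mod_lt _ hn)))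
    · exact Finset.mem_coe.2 (Finset.mem_image_of_mem _ (Finset.mem_range.2 (Nat.mod_lt _ hn)))
    · simp [factor_succ, factor_mod hf, hij]
  rw [Finset.card_image_of_injOn, Finset.card_range]
  intro i hi j hj hij
  have htail : ∀ t, factor f l (i + t) = factor f l (j + t) := by
    intro t
    induction t with
    | zero => exact hij
    | succ t ih => exact (List.cons.inj (hext _ _ ih)).2
  exact hinj i (by simpa using hi) j (by simpa using hj)
    fun t => (List.cons.inj (hext _ _ (htail t))).1

/-- An infinite word of least period `n` has a factor of length at most `n / 2` that occurs only
once per period. -/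
theorem exists_unique_factor {n : ℕ} (hn : 0 < n) (hf : Function.Periodic f n)
    (hinj : ∀ i < n, ∀ j < n, (∀ t, f (i + t) = f (j + t)) → i = j) :
    ∃ w : List A, 2 * w.length ≤ n ∧
      ((Finset.range n).filter fun i => factor f w.length i = w).card = 1 := by
  have hcard : ∀ l, min (l + 1) n ≤ ((Finset.range n).image (factor f l)).card := by
    intro l
    induction l with
    | zero =>
      have : 0 < ((Finset.range n).image (factor f 0)).card :=
        Finset.card_pos.2 ⟨_, Finset.mem_image_of_mem _ (Finset.mem_range.2 hn)⟩
      omega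
    | succ l ih =>
      by_cases h : ((Finset.range n).image (factor f l)).card < n
      · have := card_image_factor_lt hn hf hinj h
        omega
      · have : ((Finset.range n).image (factor f l)).card ≤
            ((Finset.range n).image (factor f (l + 1))).card := by
          rw [← image_take_factor_succ]
          exact Finset.card_image_le
        omega
  by_contra! hne
  have hmul : 2 * ((Finset.range n).image (factor f (n / 2))).card ≤ (Finset.range n).card := by
    refine Finset.mul_card_image_le_card _ 2 fun w hw => ?_
    obtain ⟨i, hi, rfl⟩ := Finset.mem_image.1 hw
    have hpos : 0 < ((Finset.range n).filter fun j =>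
        factor f (n / 2) j = factor f (n / 2) i).card :=
      Finset.card_pos.2 ⟨i, Finset.mem_filter.2 ⟨hi, rfl⟩⟩
    have h1 := hne (factor f (n / 2) i) (by rw [length_factor]; omega)
    rw [length_factor] at h1
    omega
  have := hcard (n / 2)
  rw [Finset.card_range] at hmul
  omega

end Factor

section OneWord

variable {f : ℕ → A} {n : ℕ}

theorem mem_properPrefixes_factor (q : List A) :
    q ∈ ProperPrefixes {factor f n 0} ↔ ∃ i < n, q = factor f i 0 := by
  constructor
  · rintro ⟨_, rfl, hq, hne⟩
    have hle : q.length ≤ n := by simpa using hq.length_le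
    have heq : q = factor f q.length 0 :=
      (List.prefix_of_prefix_length_le hq (factor_prefix hle 0) (by simp)).eq_of_length (by simp)
    exact ⟨q.length, lt_of_le_of_ne hle fun h => hne (h ▸ heq), heq⟩
  · rintro ⟨i, hi, rfl⟩
    refine ⟨_, rfl, factor_prefix hi.le 0, fun h => hi.ne ?_⟩
    simpa using congrArg List.length h

/-- The state of the literal automaton reached from the root after reading `i` letters of the
periodic word `f`. -/
def cyclicState (f : ℕ → A) (hn : 0 < n) (i : ℕ) : ProperPrefixes {factor f n 0} :=
  ⟨factor f (i % n) 0, (mem_properPrefixes_factor _).2 ⟨_, Nat.mod_lt _ hn, rfl⟩⟩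

theorem cyclicState_eq_iff (hn : 0 < n) {i j : ℕ} :
    cyclicState f hn i = cyclicState f hn j ↔ i % n = j % n := by
  refine ⟨fun h => ?_, fun h => by simp [cyclicState, h]⟩
  simpa [cyclicState] using congrArg (fun q => q.val.length) h

theorem exists_eq_cyclicState (hn : 0 < n) (q : ProperPrefixes {factor f n 0}) :
    ∃ i < n, q = cyclicState f hn i := by
  obtain ⟨i, hi, h⟩ := (mem_properPrefixes_factor _).1 q.2
  exact ⟨i, hi, Subtype.ext (by simp [cyclicState, Nat.mod_eq_of_lt hi, h])⟩

theorem litDelta_cyclicState (hn : 0 < n) (hf : Function.Periodic f n) (i : ℕ) (a : A) :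
    litDelta {factor f n 0} (cyclicState f hn i) a =
      if a = f i then some (cyclicState f hn (i + 1)) else none := by
  have hi := Nat.mod_lt i hn
  have hfac : ∀ m, factor f (i % n) 0 ++ [a] = factor f m 0 ↔ a = f i ∧ m = i % n + 1 := by
    intro m
    constructor
    · intro h
      have hm : m = i % n + 1 := by simpa using (congrArg List.length h).symm
      subst hm
      rw [factor_succ] at h
      simpa [hf.map_mod_nat] using h
    · rintro ⟨rfl, rfl⟩
      simp [factor_succ, hf.map_mod_nat]
  unfold litDelta
  split_ifs with h1 h2 h3 h4 h5
  · obtain ⟨m, hm, h⟩ := (mem_properPrefixes_factor _).1 h1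
    obtain ⟨-, rfl⟩ := (hfac m).1 h
    congr 1
    apply Subtype.ext
    change factor f (i % n) 0 ++ [a] = factor f ((i + 1) % n) 0
    rw [← Nat.mod_add_mod, Nat.mod_eq_of_lt hm]
    exact h
  · obtain ⟨m, hm, h⟩ := (mem_properPrefixes_factor _).1 h1
    exact absurd ((hfac m).1 h).1 h2
  · have h := ((hfac n).1 h3).2
    congr 1
    apply Subtype.ext
    change [] = factor f ((i + 1) % n) 0
    rw [← Nat.mod_add_mod, ← h, Nat.mod_self]
    rfl
  · exact absurd ((hfac n).1 h3).1 h4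
  · exfalso
    have h := (hfac (i % n + 1)).2 ⟨h5, rfl⟩
    rcases Nat.lt_or_ge (i % n + 1) n with hlt | hge
    · exact h1 ((mem_properPrefixes_factor _).2 ⟨_, hlt, h⟩)
    · exact h3 ((hfac n).2 ⟨h5, by omega⟩)
  · rfl

theorem stepWord_cyclicState (hn : 0 < n) (hf : Function.Periodic f n) (w : List A) (i : ℕ) :
    stepWord (litDelta {factor f n 0}) (cyclicState f hn i) w =
      if factor f w.length i = w then some (cyclicState f hn (i + w.length)) else none := by
  induction w generalizing i with
  | nil => simp [stepWord, factor]
  | cons a w ih =>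
    rw [stepWord, litDelta_cyclicState hn hf]
    by_cases h : a = f i
    · subst h
      simp [factor, ih, Nat.add_assoc, Nat.add_comm 1]
    · simp [factor, h, Ne.symm h]

/-- The rank of a word in the literal automaton of one word is its number of cyclic occurrences. -/
theorem ncard_img_litDelta (hn : 0 < n) (hf : Function.Periodic f n) (w : List A) :
    (img (litDelta {factor f n 0}) Set.univ w).ncard =
      ((Finset.range n).filter fun i => factor f w.length i = w).card := by
  have hinj : Set.InjOn (fun i => cyclicState f hn (i + w.length))
      ((Finset.range n).filter fun i => factor f w.length i = w) := by
    intro i hi j hj hij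
    have hi' : i < n ∧ factor f w.length i = w := by simpa using hi
    have hj' : j < n ∧ factor f w.length j = w := by simpa using hj
    have h : i ≡ j [MOD n] := Nat.ModEq.add_right_cancel' _ ((cyclicState_eq_iff hn).1 hij)
    exact h.eq_of_lt_of_lt hi'.1 hj'.1
  rw [← Set.ncard_coe_finset, ← hinj.ncard_image]
  congr 1
  ext p
  constructor
  · rintro ⟨q, -, hq⟩
    obtain ⟨i, hi, rfl⟩ := exists_eq_cyclicState hn q
    rw [stepWord_cyclicState hn hf] at hq
    split_ifs at hq with h
    exact ⟨i, by simp [hi, h], Option.some.inj hq⟩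
  · rintro ⟨i, hi, rfl⟩
    have hi' : i < n ∧ factor f w.length i = w := by simpa using hi
    exact ⟨cyclicState f hn i, trivial, by rw [stepWord_cyclicState hn hf, if_pos hi'.2]⟩

theorem le_card_filter_factor {k L : ℕ} (hk : 0 < k) (hL : 0 < L) (hf : Function.Periodic f L)
    {w : List A} (h : ((Finset.range (k * L)).filter fun i => factor f w.length i = w).card ≠ 0) :
    k ≤ ((Finset.range (k * L)).filter fun i => factor f w.length i = w).card := by
  obtain ⟨i, hi⟩ := Finset.card_ne_zero.1 h
  rw [Finset.mem_filter] at hi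
  have hn : 0 < k * L := Nat.mul_pos hk hL
  have hmaps : ∀ j ∈ Finset.range k, (i + j * L) % (k * L) ∈
      (Finset.range (k * L)).filter fun i => factor f w.length i = w := by
    intro j _
    refine Finset.mem_filter.2 ⟨Finset.mem_range.2 (Nat.mod_lt _ hn), ?_⟩
    rw [← factor_mod hf, Nat.mod_mul_left_mod, Nat.add_mul_mod_self_right, factor_mod hf]
    exact hi.2
  have hinj : Set.InjOn (fun j => (i + j * L) % (k * L)) (Finset.range k) := by
    intro a ha b hb hab
    have h1 : a * L ≡ b * L [MOD k * L] := Nat.ModEq.add_left_cancel' i hab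
    have h2 := Nat.ModEq.mul_right_cancel' hL.ne' h1
    exact h2.eq_of_lt_of_lt (by simpa using ha) (by simpa using hb)
  simpa using Finset.card_le_card_of_injOn _ hmaps hinj

theorem card_filter_factor_le {k L : ℕ} (hk : 0 < k) (hL : 0 < L) (hf : Function.Periodic f L)
    (hinj : ∀ i < L, ∀ j < L, (∀ t, f (i + t) = f (j + t)) → i = j) :
    ((Finset.range (k * L)).filter fun i =>
      factor f (k * L) i = factor f (k * L) 0).card ≤ k := by
  have hsub : ((Finset.range (k * L)).filter fun i => factor f (k * L) i = factor f (k * L) 0) ⊆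
      (Finset.range k).image (· * L) := by
    intro i hi
    rw [Finset.mem_filter, Finset.mem_range, factor_eq_iff] at hi
    have hmod : i % L = 0 := by
      refine hinj _ (Nat.mod_lt _ hL) _ hL fun t => ?_
      have ht : t % L < k * L := (Nat.mod_lt _ hL).trans_le (Nat.le_mul_of_pos_left L hk)
      have h := hi.2 _ ht
      rw [← hf.map_mod_nat (i + t % L), ← hf.map_mod_nat (0 + t % L), Nat.add_mod_mod,
        Nat.add_mod_mod] at h
      rw [← hf.map_mod_nat (i % L + t), ← hf.map_mod_nat (0 + t), Nat.mod_add_mod]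
      exact h
    obtain ⟨c, rfl⟩ := Nat.dvd_of_mod_eq_zero hmod
    refine Finset.mem_image.2 ⟨c, Finset.mem_range.2 ?_, mul_comm _ _⟩
    rw [mul_comm L] at hi
    exact Nat.lt_of_mul_lt_mul_right hi.1
  simpa using (Finset.card_le_card hsub).trans Finset.card_image_le

end OneWord

/-- for a one-word prefix code `X = {x}` with `x = y^k`, `y` non-empty and
primitive, `k ≥ 1`: the literal automaton `A_X` has minimal non-zero rank exactly `k`,
and if it is synchronizing then its reset threshold is at most `|x|/2`. -/
theorem stmt13 {A : Type*} [Fintype A] (x y : List A) (k : ℕ) (hk : 1 ≤ k)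
    (hy : y ≠ [])
    (hyprim : ∀ (u : List A) (m : ℕ), 2 ≤ m → y ≠ (List.replicate m u).flatten)
    (hx : x = (List.replicate k y).flatten) :
    sInf {r : ℕ | ∃ w : List A,
        (img (litDelta ({x} : Set (List A))) Set.univ w).ncard = r ∧ r ≠ 0} = k ∧
    ((∃ w : List A, (img (litDelta ({x} : Set (List A))) Set.univ w).ncard = 1) →
      2 * sInf {l : ℕ | ∃ w : List A, w.length = l ∧
          (img (litDelta ({x} : Set (List A))) Set.univ w).ncard = 1} ≤ x.length) := by
  have hL : 0 < y.length := List.length_pos_iff.2 hy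
  obtain ⟨f, hf, hfy⟩ : ∃ f : ℕ → A, Function.Periodic f y.length ∧ factor f y.length 0 = y :=
    ⟨_, fun i => by simp, factor_getElem_mod y hL⟩
  have hinj : ∀ i < y.length, ∀ j < y.length, (∀ t, f (i + t) = f (j + t)) → i = j := by
    have key : ∀ i j, i < j → j < y.length → ¬ ∀ t, f (i + t) = f (j + t) := by
      intro i j hij hj h
      obtain ⟨d, ⟨m, hm⟩, hlt, hd⟩ := exists_dvd_periodic hf hij hj h
      refine hyprim (factor f d 0) m ?_ ?_
      · by_contra! hm2
        have : d * m ≤ d * 1 := Nat.mul_le_mul_left d (by omega)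
        omega
      · rw [← factor_mul hd, mul_comm, ← hm, hfy]
    intro i hi j hj h
    rcases lt_trichotomy i j with hij | hij | hij
    · exact absurd h (key i j hij hj)
    · exact hij
    · exact absurd (fun t => (h t).symm) (key j i hij hi)
  have hn : 0 < k * y.length := Nat.mul_pos hk hL
  have hfn : Function.Periodic f (k * y.length) := by simpa using hf.nat_mul k
  have hxf : x = factor f (k * y.length) 0 := by rw [hx, factor_mul hf, hfy]
  have hrank : ∀ w : List A, (img (litDelta ({x} : Set (List A))) Set.univ w).ncard =
      ((Finset.range (k * y.length)).filter fun i => factor f w.length i = w).card := by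
    rw [hxf]
    exact ncard_img_litDelta hn hfn
  simp only [hrank]
  constructor
  · refine IsLeast.csInf_eq ⟨⟨factor f (k * y.length) 0, ?_, by omega⟩, ?_⟩
    · rw [length_factor]
      refine le_antisymm (card_filter_factor_le hk hL hf hinj) ?_
      have := le_card_filter_factor (w := factor f (k * y.length) 0) hk hL hf
      rw [length_factor] at this
      exact this (Finset.card_ne_zero.2 ⟨0, by simp [hn]⟩)
    · rintro r ⟨w, rfl, hw⟩
      exact le_card_filter_factor hk hL hf hw
  · rintro ⟨v, hv⟩
    have hk1 : k = 1 := by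
      have := le_card_filter_factor (w := v) hk hL hf (by omega)
      omega
    subst hk1
    obtain ⟨w, hlen, hw⟩ := exists_unique_factor hL hf hinj
    have hx1 : x.length = y.length := by rw [hxf, length_factor, one_mul]
    rw [hx1]
    refine le_trans (Nat.mul_le_mul_left 2 (Nat.sInf_le ?_)) hlen
    exact ⟨w, rfl, by rwa [one_mul]⟩
end

section
/- For every k ≥ 1, the literal automaton of the one-word prefix code Z = {a^k b a^{k+1} b} over the alphabet {a,b} is synchronizing, and its shortest reset word is a^{k+1}, so its reset threshold equals k + 1 = ⌊(2k+3)/2⌋. -/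
open scoped Classical

variable {A : Type*}

/-- The codeword `a^k b a^{k+1} b` over the alphabet `{a, b} = Fin 2` (with `a = 0`,
`b = 1`). -/
def zWord (k : ℕ) : List (Fin 2) :=
  List.replicate k 0 ++ [1] ++ List.replicate (k + 1) 0 ++ [1]

/-- The `i`-th letter of the periodic infinite word `(zWord k)^ω`. -/
def zLetter (k i : ℕ) : Fin 2 :=
  if i % (2 * k + 3) = k ∨ i % (2 * k + 3) = 2 * k + 2 then 1 else 0

theorem zWord_length (k : ℕ) : (zWord k).length = 2 * k + 3 := by
  simp [zWord]; omega

theorem zWord_getElem (k i : ℕ) (h : i < (zWord k).length) : (zWord k)[i] = zLetter k i := by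
  have h' := h
  rw [zWord_length] at h'
  simp only [zLetter, Nat.mod_eq_of_lt h', zWord, List.getElem_append, List.getElem_replicate,
    List.length_append, List.length_replicate, List.length_singleton, List.getElem_singleton]
  split_ifs <;> first | rfl | omega

theorem mem_properPrefixes_zWord (k : ℕ) (q : List (Fin 2)) :
    q ∈ ProperPrefixes ({zWord k} : Set (List (Fin 2))) ↔
      ∃ i < 2 * k + 3, q = (zWord k).take i := by
  constructor
  · rintro ⟨x, rfl, hp, hne⟩
    refine ⟨q.length, ?_, List.prefix_iff_eq_take.1 hp⟩
    rw [← zWord_length k]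
    exact lt_of_le_of_ne hp.length_le fun h => hne (hp.eq_of_length h)
  · rintro ⟨i, hi, rfl⟩
    refine ⟨_, rfl, List.take_prefix _ _, fun h => ?_⟩
    have := congrArg List.length h
    rw [List.length_take, zWord_length] at this
    omega

/-- The state reached from the root after reading `i` letters of `(zWord k)^ω`. -/
def zState (k i : ℕ) : ProperPrefixes ({zWord k} : Set (List (Fin 2))) :=
  ⟨(zWord k).take (i % (2 * k + 3)),
    (mem_properPrefixes_zWord k _).2 ⟨_, Nat.mod_lt _ (by omega), rfl⟩⟩

theorem zState_val (k i : ℕ) : (zState k i).val = (zWord k).take (i % (2 * k + 3)) := rfl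

theorem zState_surjective (k : ℕ) (q : ProperPrefixes ({zWord k} : Set (List (Fin 2)))) :
    ∃ i < 2 * k + 3, q = zState k i := by
  obtain ⟨i, hi, h⟩ := (mem_properPrefixes_zWord k q).1 q.2
  exact ⟨i, hi, Subtype.ext (by rw [h, zState_val, Nat.mod_eq_of_lt hi])⟩

theorem zState_inj (k i j : ℕ) : zState k i = zState k j ↔ i ≡ j [MOD 2 * k + 3] := by
  constructor
  · intro h
    have h := congrArg (fun q => q.val.length) h
    have hi := Nat.mod_lt i (show 0 < 2 * k + 3 by omega)
    have hj := Nat.mod_lt j (show 0 < 2 * k + 3 by omega)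
    simp only [zState, List.length_take, zWord_length] at h
    rw [min_eq_left hi.le, min_eq_left hj.le] at h
    exact h
  · intro h
    exact Subtype.ext (congrArg (fun m => (zWord k).take m) h)

theorem litDelta_zState (k i : ℕ) (c : Fin 2) :
    litDelta ({zWord k} : Set (List (Fin 2))) (zState k i) c =
      if c = zLetter k i then some (zState k (i + 1)) else none := by
  have hr : i % (2 * k + 3) < 2 * k + 3 := Nat.mod_lt _ (by omega)
  have hr' : i % (2 * k + 3) < (zWord k).length := by rwa [zWord_length]
  have hsucc : (zWord k).take (i % (2 * k + 3)) ++ [zLetter k i] =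
      (zWord k).take (i % (2 * k + 3) + 1) := by
    rw [← List.take_concat_get' _ _ hr', zWord_getElem]
    simp [zLetter]
  have hlast : ∀ m, (zWord k).take (i % (2 * k + 3)) ++ [c] = (zWord k).take m →
      c = zLetter k i := by
    intro m h
    have hlen := congrArg List.length h
    simp only [List.length_append, List.length_take, List.length_singleton, zWord_length] at hlen
    have hm : ((zWord k).take m) = (zWord k).take (i % (2 * k + 3) + 1) :=
      List.take_eq_take_iff.2 (by rw [zWord_length]; omega)
    rw [hm, ← hsucc] at h
    simpa using h
  by_cases hc : c = zLetter k i
  · rw [if_pos hc]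
    subst hc
    by_cases hn : i % (2 * k + 3) + 1 < 2 * k + 3
    · have hmem : (zState k i).val ++ [zLetter k i] ∈
          ProperPrefixes ({zWord k} : Set (List (Fin 2))) :=
        (mem_properPrefixes_zWord k _).2 ⟨_, hn, hsucc⟩
      rw [litDelta, dif_pos hmem]
      refine congrArg some (Subtype.ext ?_)
      change (zWord k).take (i % (2 * k + 3)) ++ [zLetter k i] = _
      rw [hsucc, zState_val, ← Nat.mod_add_mod, Nat.mod_eq_of_lt hn]
    · have hn' : i % (2 * k + 3) + 1 = 2 * k + 3 := by omega
      have heq : (zState k i).val ++ [zLetter k i] = zWord k := by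
        change (zWord k).take (i % (2 * k + 3)) ++ [zLetter k i] = _
        rw [hsucc, hn', List.take_of_length_le (zWord_length k).le]
      have hmem : (zState k i).val ++ [zLetter k i] ∉
          ProperPrefixes ({zWord k} : Set (List (Fin 2))) := by
        rintro ⟨x, rfl, -, hne⟩
        exact hne heq
      rw [litDelta, dif_neg hmem, dif_pos (show _ ∈ ({zWord k} : Set _) from heq)]
      refine congrArg some (Subtype.ext ?_)
      change [] = (zWord k).take _
      rw [← Nat.mod_add_mod, hn', Nat.mod_self, List.take_zero]
  · rw [if_neg hc, litDelta, dif_neg, dif_neg]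
    · intro h
      refine hc (hlast (2 * k + 3) ?_)
      rw [List.take_of_length_le (zWord_length k).le]
      exact h
    · intro h
      obtain ⟨m, -, hm⟩ := (mem_properPrefixes_zWord k _).1 h
      exact hc (hlast m hm)

theorem stepWord_zState (k : ℕ) (w : List (Fin 2)) (i : ℕ)
    (s : ProperPrefixes ({zWord k} : Set (List (Fin 2)))) :
    stepWord (litDelta ({zWord k} : Set (List (Fin 2)))) (zState k i) w = some s ↔
      (∀ j, ∀ h : j < w.length, w[j] = zLetter k (i + j)) ∧ s = zState k (i + w.length) := by
  induction w generalizing i with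
  | nil => simp [stepWord, eq_comm]
  | cons c w ih =>
    rw [stepWord, litDelta_zState]
    by_cases hc : c = zLetter k i
    · rw [if_pos hc, Option.bind_some, ih,
        show i + 1 + w.length = i + (c :: w).length by rw [List.length_cons]; omega]
      refine and_congr_left fun _ => ⟨fun h j hj => ?_, fun h j hj => ?_⟩
      · cases j with
        | zero => exact hc
        | succ j =>
          rw [List.getElem_cons_succ, h, show i + 1 + j = i + (j + 1) by omega]
      · have := h (j + 1) (by simpa using hj)
        rwa [List.getElem_cons_succ, show i + (j + 1) = i + 1 + j by omega] at this
    · rw [if_neg hc]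
      simp only [Option.bind_none, reduceCtorEq, false_iff, not_and]
      intro h
      exact absurd (h 0 (by simp)) hc

theorem mod_eq_ite_of_lt_two_mul {m n : ℕ} (h : m < 2 * n) :
    m % n = if m < n then m else m - n := by
  split_ifs with h'
  · exact Nat.mod_eq_of_lt h'
  · rw [Nat.mod_eq_sub_mod (by omega), Nat.mod_eq_of_lt (by omega)]

/-- Every factor of `(zWord k)^ω` of length at most `k` occurs at two distinct positions modulo
the period. -/
theorem exists_ne_zLetter_eq (k i : ℕ) (hi : i < 2 * k + 3) :
    ∃ i' < 2 * k + 3, i' ≠ i ∧ ∀ j < k, zLetter k (i + j) = zLetter k (i' + j) := by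
  have key : ∀ i' < 2 * k + 3,
      (i = 0 ∧ i' = k + 1) ∨ (1 ≤ i ∧ i ≤ k ∧ i' = i + k + 2) ∨
        ((i = k + 1 ∨ i = k + 2) ∧ i' = 0) ∨ (k + 3 ≤ i ∧ i' = i - (k + 2)) →
      ∀ j < k, zLetter k (i + j) = zLetter k (i' + j) := by
    intro i' hi' h j hj
    rw [zLetter, zLetter, mod_eq_ite_of_lt_two_mul (show i + j < _ by omega),
      mod_eq_ite_of_lt_two_mul (show i' + j < _ by omega)]
    refine if_congr ?_ rfl rfl
    split_ifs <;> omega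
  by_cases h0 : i = 0
  · exact ⟨k + 1, by omega, by omega, key _ (by omega) (by omega)⟩
  by_cases h1 : i ≤ k
  · exact ⟨i + k + 2, by omega, by omega, key _ (by omega) (by omega)⟩
  by_cases h2 : i ≤ k + 2
  · exact ⟨0, by omega, by omega, key _ (by omega) (by omega)⟩
  · exact ⟨i - (k + 2), by omega, by omega, key _ (by omega) (by omega)⟩

theorem img_zWord_replicate (k : ℕ) :
    img (litDelta ({zWord k} : Set (List (Fin 2)))) Set.univ
      (List.replicate (k + 1) (0 : Fin 2)) = {zState k (2 * k + 2)} := by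
  have hz : ∀ m, m < 2 * (2 * k + 3) →
      (zLetter k m = 0 ↔ m ≠ k ∧ m ≠ 2 * k + 2 ∧ m ≠ 3 * k + 3 ∧ m ≠ 4 * k + 5) := by
    intro m hm
    rw [zLetter, mod_eq_ite_of_lt_two_mul hm]
    split_ifs <;> simp <;> omega
  ext s
  simp only [img, Set.mem_univ, true_and, Set.mem_ofPred_eq, Set.mem_singleton_iff]
  constructor
  · rintro ⟨q, hq⟩
    obtain ⟨i, hi, rfl⟩ := zState_surjective k q
    rw [stepWord_zState] at hq
    obtain ⟨h, rfl⟩ := hq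
    simp only [List.length_replicate, List.getElem_replicate] at h ⊢
    have h' : ∀ j < k + 1, i + j ≠ k ∧ i + j ≠ 2 * k + 2 ∧ i + j ≠ 3 * k + 3 := fun j hj => by
      have := (hz (i + j) (by omega)).1 (h j hj).symm
      omega
    have a := h' (k - i)
    have b := h' (2 * k + 2 - i)
    rw [show i + (k + 1) = 2 * k + 2 by omega]
  · rintro rfl
    refine ⟨zState k (k + 1), (stepWord_zState _ _ _ _).2 ⟨fun j hj => ?_, ?_⟩⟩
    · rw [List.length_replicate] at hj
      rw [List.getElem_replicate, (hz (k + 1 + j) (by omega)).2 (by omega)]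
    · rw [List.length_replicate, show k + 1 + (k + 1) = 2 * k + 2 by omega]

theorem lt_length_of_ncard_img_zWord_eq_one (k : ℕ) (w : List (Fin 2))
    (hw : (img (litDelta ({zWord k} : Set (List (Fin 2)))) Set.univ w).ncard = 1) :
    k < w.length := by
  by_contra! hlen
  obtain ⟨s, hs⟩ := Set.ncard_eq_one.1 hw
  obtain ⟨q, -, hq⟩ := hs.ge (Set.mem_singleton s)
  obtain ⟨i, hi, rfl⟩ := zState_surjective k q
  obtain ⟨hacc, rfl⟩ := (stepWord_zState _ _ _ _).1 hq
  obtain ⟨i', hi', hne, hz⟩ := exists_ne_zLetter_eq k i hi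
  have hmem : zState k (i' + w.length) ∈
      img (litDelta ({zWord k} : Set (List (Fin 2)))) Set.univ w :=
    ⟨zState k i', Set.mem_univ _, (stepWord_zState _ _ _ _).2
      ⟨fun j hj => (hacc j hj).trans (hz j (by omega)), rfl⟩⟩
  rw [hs, Set.mem_singleton_iff, zState_inj] at hmem
  exact hne ((Nat.ModEq.add_right_cancel' _ hmem).eq_of_lt_of_lt hi' hi)

/-- for every `k ≥ 1`, the literal automaton of the one-word prefix code
`Z = {a^k b a^{k+1} b}` is synchronizing; `a^{k+1}` is a reset word for it and its
reset threshold equals `k + 1 = ⌊(2k+3)/2⌋`. -/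
theorem stmt14 (k : ℕ) (hk : 1 ≤ k) :
    (img (litDelta ({zWord k} : Set (List (Fin 2)))) Set.univ
        (List.replicate (k + 1) (0 : Fin 2))).ncard = 1 ∧
    sInf {l : ℕ | ∃ w : List (Fin 2), w.length = l ∧
        (img (litDelta ({zWord k} : Set (List (Fin 2)))) Set.univ w).ncard = 1} = k + 1 ∧
    k + 1 = (2 * k + 3) / 2 := by
  have hreset : (img (litDelta ({zWord k} : Set (List (Fin 2)))) Set.univ
      (List.replicate (k + 1) (0 : Fin 2))).ncard = 1 := by
    rw [img_zWord_replicate, Set.ncard_singleton]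
  refine ⟨hreset, le_antisymm (Nat.sInf_le ⟨_, List.length_replicate, hreset⟩) ?_, by omega⟩
  refine le_csInf ⟨_, _, List.length_replicate, hreset⟩ ?_
  rintro l ⟨w, rfl, hw⟩
  exact lt_length_of_ncard_img_zWord_eq_one k w hw
end

section
/- Let A = (Q, Σ, δ) be a strongly connected complete DFA with n states. Then for every r with 1 ≤ r < n, the duplicating automaton A^D satisfies rt(A^D, r) = 2·rt(A, r), where rt(·, r) denotes the minimum length of a word of rank r. -/
open scoped Classical

variable {Q A : Type*}

/-- The duplicating automaton `A^D` of a complete DFA `δc`: states `Q ⊕ Q` (the left copy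
is `Q`, the right copy is `Q'`), alphabet `Option A` where `none` is the fresh letter `γ`:
`δ^D(q,a) = q`, `δ^D(q,γ) = q'`, `δ^D(q',a) = δ(q,a)`, `δ^D(q',γ) = ⊥`. -/
def dupDelta (δc : Q → A → Q) : (Q ⊕ Q) → Option A → Option (Q ⊕ Q)
  | Sum.inl q, some _ => some (Sum.inl q)
  | Sum.inl q, none => some (Sum.inr q)
  | Sum.inr q, some a => some (Sum.inl (δc q a))
  | Sum.inr _, none => none

theorem img_nil (δ : Q → A → Option Q) (S : Set Q) : img δ S [] = S := by
  ext p
  simp [img, stepWord]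

theorem img_cons (δ : Q → A → Option Q) (S : Set Q) (a : A) (w : List A) :
    img δ S (a :: w) = img δ {p | ∃ q ∈ S, δ q a = some p} w := by
  ext p
  simp only [img, stepWord, Option.bind_eq_some_iff, Set.mem_ofPred_eq]
  tauto

theorem img_empty (δ : Q → A → Option Q) (w : List A) : img δ ∅ w = ∅ := by
  simp [img]

theorem imgC_nil (δc : Q → A → Q) (S : Set Q) : imgC δc S [] = S := by
  simp [imgC, stepWordC]

theorem imgC_cons (δc : Q → A → Q) (S : Set Q) (a : A) (w : List A) :
    imgC δc S (a :: w) = imgC δc ((fun q => δc q a) '' S) w := by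
  simp [imgC, stepWordC, Set.image_image]

theorem img_dupDelta_inl_some (δc : Q → A → Q) (S : Set Q) (a : A) (w : List (Option A)) :
    img (dupDelta δc) (Sum.inl '' S) (some a :: w) = img (dupDelta δc) (Sum.inl '' S) w := by
  rw [img_cons]
  congr 1
  ext p
  simp [dupDelta]

theorem img_dupDelta_inl_none (δc : Q → A → Q) (S : Set Q) (w : List (Option A)) :
    img (dupDelta δc) (Sum.inl '' S) (none :: w) = img (dupDelta δc) (Sum.inr '' S) w := by
  rw [img_cons]
  congr 1
  ext p
  simp [dupDelta]

theorem img_dupDelta_inr_some (δc : Q → A → Q) (S : Set Q) (a : A) (w : List (Option A)) :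
    img (dupDelta δc) (Sum.inr '' S) (some a :: w) =
      img (dupDelta δc) (Sum.inl '' ((fun q => δc q a) '' S)) w := by
  rw [img_cons]
  congr 1
  ext p
  simp [dupDelta]

theorem img_dupDelta_inr_none (δc : Q → A → Q) (S : Set Q) (w : List (Option A)) :
    img (dupDelta δc) (Sum.inr '' S) (none :: w) = ∅ := by
  rw [img_cons, ← img_empty (dupDelta δc) w]
  congr 1
  ext p
  simp [dupDelta]

theorem img_dupDelta_univ_some (δc : Q → A → Q) (a : A) (w : List (Option A)) :
    img (dupDelta δc) Set.univ (some a :: w) =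
      img (dupDelta δc) (Sum.inl '' Set.univ) w := by
  rw [img_cons]
  congr 1
  ext (p | p) <;> simp [dupDelta]

theorem img_dupDelta_univ_none (δc : Q → A → Q) (w : List (Option A)) :
    img (dupDelta δc) Set.univ (none :: w) =
      img (dupDelta δc) (Sum.inr '' Set.univ) w := by
  rw [img_cons]
  congr 1
  ext (p | p) <;> simp [dupDelta]

/-- The word `γ a₁ γ a₂ ⋯ γ aₖ` acts on the left copy of `Q` as `a₁ a₂ ⋯ aₖ` acts on `Q`. -/
theorem img_dupDelta_inl_flatMap (δc : Q → A → Q) (S : Set Q) (v : List A) :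
    img (dupDelta δc) (Sum.inl '' S) (v.flatMap fun a => [none, some a]) =
      Sum.inl '' imgC δc S v := by
  induction v generalizing S with
  | nil => simp [img_nil, imgC_nil]
  | cons a v ih =>
    rw [List.flatMap_cons, List.cons_append, List.cons_append, List.nil_append,
      img_dupDelta_inl_none, img_dupDelta_inr_some, ih, imgC_cons]

/-- Starting from one copy of `S`, a word `w` that keeps some state alive acts like a word over
the original alphabet of at most half the length (counting an extra `γ` from the right copy). -/
theorem exists_imgC_ncard_eq (δc : Q → A → Q) (w : List (Option A)) (S : Set Q) :
    ((img (dupDelta δc) (Sum.inl '' S) w).ncard ≠ 0 →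
      ∃ v : List A, 2 * v.length ≤ w.length ∧
        (imgC δc S v).ncard = (img (dupDelta δc) (Sum.inl '' S) w).ncard) ∧
    ((img (dupDelta δc) (Sum.inr '' S) w).ncard ≠ 0 →
      ∃ v : List A, 2 * v.length ≤ w.length + 1 ∧
        (imgC δc S v).ncard = (img (dupDelta δc) (Sum.inr '' S) w).ncard) := by
  induction w generalizing S with
  | nil =>
    exact ⟨fun _ => ⟨[], by simp, by
        rw [img_nil, imgC_nil, Set.ncard_image_of_injective _ Sum.inl_injective]⟩,
      fun _ => ⟨[], by simp, by
        rw [img_nil, imgC_nil, Set.ncard_image_of_injective _ Sum.inr_injective]⟩⟩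
  | cons a w ih =>
    cases a with
    | none =>
      rw [img_dupDelta_inl_none, img_dupDelta_inr_none]
      exact ⟨(ih S).2, fun h => absurd (Set.ncard_empty _) h⟩
    | some a =>
      rw [img_dupDelta_inl_some, img_dupDelta_inr_some]
      refine ⟨fun h => ?_, fun h => ?_⟩
      · obtain ⟨v, hv, hS⟩ := (ih S).1 h
        exact ⟨v, hv.trans (Nat.le_succ _), hS⟩
      · obtain ⟨v, hv, hS⟩ := (ih _).1 h
        exact ⟨a :: v, by simp only [List.length_cons]; omega, by rw [imgC_cons, hS]⟩

theorem sInf_eq_two_mul_sInf {B C : Set ℕ} (hCB : ∀ k ∈ C, 2 * k ∈ B)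
    (hBC : ∀ m ∈ B, ∃ k ∈ C, 2 * k ≤ m) : sInf B = 2 * sInf C := by
  rcases C.eq_empty_or_nonempty with rfl | hC
  · have hB : B = ∅ := Set.eq_empty_of_forall_notMem fun m hm => by
      obtain ⟨k, hk, -⟩ := hBC m hm
      exact hk
    simp [hB]
  · have hmem := hCB _ (Nat.sInf_mem hC)
    obtain ⟨k, hk, hle⟩ := hBC _ (Nat.sInf_mem ⟨_, hmem⟩)
    exact (Nat.sInf_le hmem).antisymm ((Nat.mul_le_mul_left 2 (Nat.sInf_le hk)).trans hle)

/-- for a strongly connected complete DFA `A` with `n` states and every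
`1 ≤ r < n`, the rank thresholds satisfy `rt(A^D, r) = 2·rt(A, r)`. -/
theorem stmt17 {Q A : Type*} [Fintype Q] (δc : Q → A → Q)
    (hsc : ∀ p q : Q, ∃ w : List A, stepWordC δc p w = q)
    (r : ℕ) (hr1 : 1 ≤ r) (hrn : r < Fintype.card Q) :
    sInf {k : ℕ | ∃ w : List (Option A), w.length = k ∧
        (img (dupDelta δc) Set.univ w).ncard = r} =
      2 * sInf {k : ℕ | ∃ w : List A, w.length = k ∧
        (imgC δc Set.univ w).ncard = r} := by
  apply sInf_eq_two_mul_sInf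
  · rintro _ ⟨v, rfl, hv⟩
    refine ⟨v.flatMap fun a => [none, some a], by simp [mul_comm], ?_⟩
    cases v with
    | nil =>
      rw [imgC_nil, Set.ncard_univ, Nat.card_eq_fintype_card] at hv
      omega
    | cons a v =>
      have h := img_dupDelta_inl_flatMap δc Set.univ (a :: v)
      rw [List.flatMap_cons, List.cons_append, img_dupDelta_inl_none] at h
      rw [List.flatMap_cons, List.cons_append, img_dupDelta_univ_none, h,
        Set.ncard_image_of_injective _ Sum.inl_injective, hv]
  · rintro _ ⟨w, rfl, hw⟩
    rcases w with _ | ⟨_ | a, w⟩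
    · rw [img_nil, Set.ncard_univ, Nat.card_eq_fintype_card, Fintype.card_sum] at hw
      omega
    · rw [img_dupDelta_univ_none] at hw
      obtain ⟨v, hv, h⟩ := (exists_imgC_ncard_eq δc w Set.univ).2 (by omega)
      exact ⟨v.length, ⟨v, rfl, h.trans hw⟩, hv⟩
    · rw [img_dupDelta_univ_some] at hw
      obtain ⟨v, hv, h⟩ := (exists_imgC_ncard_eq δc w Set.univ).1 (by omega)
      exact ⟨v.length, ⟨v, rfl, h.trans hw⟩, hv.trans (Nat.le_succ _)⟩
end
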